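/- arXiv:math/0207228 — 3 statements merged into one kernel-verified Lean document; each statement's English description precedes it below -/
import Mathlib

section
/- Let G be a group, n a natural number, and ρ : G → GL(n, ℤ) a group homomorphism such that for every g ∈ G the complex matrix obtained from ρ(g) by applying the canonical ring map ℤ → ℂ to each entry is unitary. Then the image of ρ is a finite group. -/
/-- The integer matrices whose complexification is unitary form a finite set. -/
theorem Matrix.finite_setOf_intCast_map_mem_unitaryGroup (n : Type*) [Fintype n] [DecidableEq n] :
    {A : Matrix n n ℤ | A.map (Int.cast : ℤ → ℂ) ∈ Matrix.unitaryGroup n ℂ}.Finite := by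
  refine (Set.Finite.pi' fun _ : n => Set.Finite.pi' fun _ : n =>
    Set.finite_Icc (-1 : ℤ) 1).subset fun A hA i j => ?_
  have hbound : ‖(A i j : ℂ)‖ ≤ 1 := entry_norm_bound_of_unitary hA i j
  rw [Complex.norm_intCast] at hbound
  exact abs_le.mp (by exact_mod_cast hbound)

/-- A representation `ρ : G → GL(n, ℤ)` all of whose values become unitary complex
matrices has finite image. -/
theorem finite_range_of_integral_unitary_representation
    (G : Type*) [Group G] (n : ℕ)
    (ρ : G →* Matrix.GeneralLinearGroup (Fin n) ℤ)
    (h : ∀ g : G,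
      (((ρ g : Matrix (Fin n) (Fin n) ℤ).map (Int.cast : ℤ → ℂ)).conjTranspose) *
        ((ρ g : Matrix (Fin n) (Fin n) ℤ).map (Int.cast : ℤ → ℂ)) = 1) :
    Finite ρ.range := by
  refine Set.Finite.to_subtype (Set.Finite.of_finite_image
    ((Matrix.finite_setOf_intCast_map_mem_unitaryGroup (Fin n)).subset ?_)
    Units.val_injective.injOn)
  rintro _ ⟨_, ⟨g, rfl⟩, rfl⟩
  exact Matrix.mem_unitaryGroup_iff'.mpr (h g)
end

section
/- Let r ≥ 1 be a natural number and for each i ∈ {1, …, r} let g_i, ν_i, e_i, d_i be positive integers such that e_i · d_i² ≤ 2 · g_i for every i, and such that e_i = 1 and d_i = 1 whenever g_i = 1. If (∑_{i=1}^r ν_i · g_i)² ≤ ∑_{i=1}^r e_i · d_i² · ν_i², then r = 1 and g_1 ≤ 2. -/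
/-- For at least two positive summands, the sum of squares is less than the square of the sum. -/
lemma sum_sq_lt_sq_sum_of_nontrivial {ι : Type*} [Fintype ι] [Nontrivial ι] (x : ι → ℕ)
    (hx : ∀ i, 0 < x i) : ∑ i, x i ^ 2 < (∑ i, x i) ^ 2 := by
  rw [sq (∑ i, x i), Finset.sum_mul]
  refine Finset.sum_lt_sum_of_nonempty Finset.univ_nonempty fun i _ => ?_
  obtain ⟨j, hj⟩ := exists_ne i
  have hlt : x i < ∑ k, x k :=
    Finset.single_lt_sum hj (Finset.mem_univ i) (Finset.mem_univ j) (hx j) fun _ _ _ => zero_le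
  rw [sq]
  exact Nat.mul_lt_mul_of_pos_left hlt (hx i)

/-- The numerical lemma from the proof of Theorem 0.2 (geomsplit): if
`eᵢ · dᵢ² ≤ 2 gᵢ` for all `i`, with `eᵢ = dᵢ = 1` whenever `gᵢ = 1`, and if
`(∑ νᵢ gᵢ)² ≤ ∑ eᵢ dᵢ² νᵢ²`, then `r = 1` and `g₁ ≤ 2`. -/
theorem numerical_lemma_geomsplit
    (r : ℕ) (hr : 1 ≤ r) (g ν e d : Fin r → ℕ)
    (hg : ∀ i, 0 < g i) (hν : ∀ i, 0 < ν i) (he : ∀ i, 0 < e i) (hd : ∀ i, 0 < d i)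
    (hbound : ∀ i, e i * (d i) ^ 2 ≤ 2 * g i)
    (hell : ∀ i, g i = 1 → e i = 1 ∧ d i = 1)
    (hineq : (∑ i, ν i * g i) ^ 2 ≤ ∑ i, e i * (d i) ^ 2 * (ν i) ^ 2) :
    r = 1 ∧ ∀ i, g i ≤ 2 := by
  have hle : ∀ i, e i * d i ^ 2 ≤ g i ^ 2 := by
    intro i
    rcases Nat.eq_or_lt_of_le (hg i) with h | h
    · obtain ⟨h1, h2⟩ := hell i h.symm
      simp [h1, h2, ← h]
    · have := hbound i
      nlinarith
  have hr1 : r = 1 := by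
    by_contra hne
    have : Nontrivial (Fin r) := Fin.nontrivial_iff_two_le.mpr (by omega)
    have hlt := sum_sq_lt_sq_sum_of_nontrivial (fun i => ν i * g i)
      fun i => Nat.mul_pos (hν i) (hg i)
    refine absurd (hlt.trans_le hineq) (not_lt.mpr (Finset.sum_le_sum fun i _ => ?_))
    rw [mul_pow, mul_comm]
    exact Nat.mul_le_mul_left _ (hle i)
  subst hr1
  refine ⟨rfl, fun i => ?_⟩
  obtain rfl : i = 0 := Subsingleton.elim _ _
  simp only [Fin.sum_univ_one] at hineq
  rw [mul_pow, mul_comm] at hineq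
  have h := Nat.le_of_mul_le_mul_right hineq (pow_pos (hν 0) 2)
  nlinarith [hbound 0, hg 0]
end

section
/- Let L ⊆ ℂ be a subfield each of whose elements is algebraic over ℚ, let n ≥ 1 be a natural number, and let S be a set of polynomials in n variables with coefficients in L. Let Z = {z ∈ ℂⁿ : p(z) = 0 for all p ∈ S} be the common zero set, equipped with the subspace topology induced from the standard (Euclidean) topology on ℂⁿ. If z₀ is an isolated point of Z, then every coordinate of z₀ is algebraic over ℚ. -/
open MvPolynomial

/-- A polynomial over an algebraically closed subfield of `ℂ` which takes a small value at `a`,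
relative to its leading coefficient, has a root close to `a`. -/
theorem exists_isRoot_norm_sub_lt {K : Type*} [Field K] [IsAlgClosed K] [Algebra K ℂ]
    (f : Polynomial K) (a : ℂ) {ε : ℝ} (hε : 0 ≤ ε)
    (h : ‖Polynomial.aeval a f‖ < ‖algebraMap K ℂ f.leadingCoeff‖ * ε ^ f.natDegree) :
    ∃ r, f.eval r = 0 ∧ ‖a - algebraMap K ℂ r‖ < ε := by
  by_contra! hr
  have hf : f ≠ 0 := by
    rintro rfl
    simp at h
  have hs := IsAlgClosed.splits f
  have key : ∀ s : Multiset K, (∀ r ∈ s, ε ≤ ‖a - algebraMap K ℂ r‖) →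
      ε ^ s.card ≤ ‖(s.map fun r => a - algebraMap K ℂ r).prod‖ := by
    intro s
    induction s using Multiset.induction with
    | empty => simp
    | cons r s ih =>
      intro hs
      rw [Multiset.map_cons, Multiset.prod_cons, Multiset.card_cons, pow_succ', norm_mul]
      exact mul_le_mul (hs r (Multiset.mem_cons_self r s))
        (ih fun x hx => hs x (Multiset.mem_cons_of_mem hx)) (by positivity) (norm_nonneg _)
  have h1 := key f.roots fun r hx => hr r (Polynomial.isRoot_of_mem_roots hx)
  rw [← hs.natDegree_eq_card_roots] at h1
  have h2 : Polynomial.aeval a f = algebraMap K ℂ f.leadingCoeff *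
      (f.roots.map fun r => a - algebraMap K ℂ r).prod := by
    conv_lhs => rw [hs.eq_prod_roots]
    simp [map_multiset_prod, Multiset.map_map]
  rw [h2, norm_mul] at h
  exact absurd h (not_lt.mpr (mul_le_mul_of_nonneg_left h1 (norm_nonneg _)))

/-- Let `P` be a polynomial of least degree among those that vanish at `a` under `φ` without
vanishing identically under `φ`. If `ψ` kills the kernel of `φ` but not the leading coefficient
of `P`, then a root `b` of `P` under `ψ` is a specialization of `a`. -/
theorem eval₂_eq_zero_of_minimal {A F K : Type*} [CommRing A] [IsDomain A] [Field F] [Field K]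
    {φ : A →+* F} {ψ : A →+* K} (hφψ : ∀ q, φ q = 0 → ψ q = 0) {a : F} {b : K}
    {P : Polynomial A} (hPa : P.eval₂ φ a = 0)
    (hmin : ∀ Q : Polynomial A, Q.eval₂ φ a = 0 → Q.degree < P.degree → Q.map φ = 0)
    (hlc : ψ P.leadingCoeff ≠ 0) (hPb : P.eval₂ ψ b = 0)
    (Q : Polynomial A) (hQ : Q.eval₂ φ a = 0) : Q.eval₂ ψ b = 0 := by
  have hP : P ≠ 0 := by
    rintro rfl
    simp at hlc
  induction hd : Q.degree using WellFoundedLT.induction generalizing Q with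
  | ind d ih =>
    subst hd
    by_cases hlt : Q.degree < P.degree
    · have h0 := hmin Q hQ hlt
      have h1 : Q.map ψ = 0 := by
        ext k
        have := congrArg (fun R => R.coeff k) h0
        simp only [Polynomial.coeff_map, Polynomial.coeff_zero] at this ⊢
        exact hφψ _ this
      rw [← Polynomial.eval_map, h1, Polynomial.eval_zero]
    · have hle : P.degree ≤ Q.degree := not_lt.mp hlt
      have hQ0 : Q ≠ 0 := by
        rintro rfl
        simp [hP] at hle
      have hnat : P.natDegree ≤ Q.natDegree := Polynomial.natDegree_le_natDegree hle
      have hcP : P.leadingCoeff ≠ 0 := Polynomial.leadingCoeff_ne_zero.mpr hP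
      have hcQ : Q.leadingCoeff ≠ 0 := Polynomial.leadingCoeff_ne_zero.mpr hQ0
      set R := Polynomial.C P.leadingCoeff * Q -
        Polynomial.C Q.leadingCoeff * Polynomial.X ^ (Q.natDegree - P.natDegree) * P with hR
      have hdeg : R.degree < Q.degree := by
        have e1 : (Polynomial.C P.leadingCoeff * Q).degree = Q.degree := by
          rw [Polynomial.degree_mul, Polynomial.degree_C hcP, zero_add]
        rw [← e1]
        refine Polynomial.degree_sub_lt_left ?_ (mul_ne_zero (Polynomial.C_ne_zero.mpr hcP) hQ0) ?_
        · rw [e1, Polynomial.degree_mul, Polynomial.degree_C_mul_X_pow _ hcQ,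
            Polynomial.degree_eq_natDegree hP, Polynomial.degree_eq_natDegree hQ0]
          norm_cast
          omega
        · rw [Polynomial.leadingCoeff_mul, Polynomial.leadingCoeff_mul,
            Polynomial.leadingCoeff_C_mul_X_pow, Polynomial.leadingCoeff_C, mul_comm]
      have hRa : R.eval₂ φ a = 0 := by
        simp [hR, Polynomial.eval₂_sub, Polynomial.eval₂_mul, hQ, hPa]
      have hRb := ih _ hdeg R hRa rfl
      simpa [hR, Polynomial.eval₂_sub, Polynomial.eval₂_mul, hPb, hlc] using hRb

/-- A polynomial of least degree among those vanishing at `a` under `φ` without vanishing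
identically has a leading coefficient outside the kernel of `φ`. -/
theorem exists_minimal_eval₂_eq_zero {A F : Type*} [CommRing A] [Field F]
    {φ : A →+* F} {a : F} (h : ∃ P : Polynomial A, P.eval₂ φ a = 0 ∧ P.map φ ≠ 0) :
    ∃ P : Polynomial A, P.eval₂ φ a = 0 ∧ φ P.leadingCoeff ≠ 0 ∧
      ∀ Q : Polynomial A, Q.eval₂ φ a = 0 → Q.degree < P.degree → Q.map φ = 0 := by
  obtain ⟨P, ⟨hPa, hP0⟩, hmin⟩ := (InvImage.wf (Polynomial.degree (R := A))
    wellFounded_lt).has_min {P | P.eval₂ φ a = 0 ∧ P.map φ ≠ 0} h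
  have hmin' : ∀ Q : Polynomial A, Q.eval₂ φ a = 0 → Q.degree < P.degree → Q.map φ = 0 := by
    intro Q hQ hlt
    by_contra h0
    exact hmin Q ⟨hQ, h0⟩ hlt
  refine ⟨P, hPa, fun hlc => ?_, hmin'⟩
  have hP : P ≠ 0 := by
    rintro rfl
    simp at hP0
  have hmap : P.eraseLead.map φ = P.map φ := by
    conv_rhs => rw [← P.eraseLead_add_C_mul_X_pow]
    rw [Polynomial.map_add, Polynomial.map_mul, Polynomial.map_C, hlc, Polynomial.C_0, zero_mul,
      add_zero]
  refine hP0 (hmap ▸ hmin' _ ?_ (Polynomial.degree_eraseLead_lt hP))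
  rw [← Polynomial.eval_map, hmap, Polynomial.eval_map, hPa]

/-- Over a dense algebraically closed subfield `K` of `ℂ`, every complex point has arbitrarily
close `K`-rational specializations. -/
theorem exists_specialization_mem_nhds {K : Type*} [Field K] [IsAlgClosed K] [Algebra K ℂ]
    (hK : DenseRange (algebraMap K ℂ)) {n : ℕ} (z : Fin n → ℂ) {U : Set (Fin n → ℂ)}
    (hU : U ∈ nhds z) :
    ∃ w : Fin n → K, (fun i => algebraMap K ℂ (w i)) ∈ U ∧
      ∀ p : MvPolynomial (Fin n) K, aeval z p = 0 → eval w p = 0 := by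
  induction n with
  | zero =>
    refine ⟨Fin.elim0, ?_, fun p hp => ?_⟩
    · rw [Subsingleton.elim (fun i => algebraMap K ℂ (Fin.elim0 i)) z]
      exact mem_of_mem_nhds hU
    · obtain ⟨c, rfl⟩ := C_surjective (Fin 0) p
      simpa using hp
  | succ n ih =>
    obtain ⟨a, z, rfl⟩ : ∃ a z', z = Fin.cons a z' := ⟨z 0, Fin.tail z, (Fin.cons_self_tail z).symm⟩
    have hcons : Continuous fun x : ℂ × (Fin n → ℂ) => (Fin.cons x.1 x.2 : Fin (n + 1) → ℂ) :=
      Continuous.finCons (A := fun _ => ℂ) continuous_fst continuous_snd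
    obtain ⟨V, hV, W, hW, hVW⟩ := mem_nhds_prod_iff.mp
      (hcons.continuousAt.preimage_mem_nhds (x := (a, z)) hU)
    obtain ⟨ε, hε, hεV⟩ := Metric.mem_nhds_iff.mp hV
    have haeval : ∀ p : MvPolynomial (Fin (n + 1)) K, aeval (Fin.cons a z : Fin (n + 1) → ℂ) p =
        (finSuccEquiv K n p).eval₂ (aeval z : MvPolynomial (Fin n) K →ₐ[K] ℂ).toRingHom a := by
      intro p
      induction p using MvPolynomial.induction_on with
      | C c => simp [finSuccEquiv_apply]
      | add p q hp hq => simp [hp, hq, Polynomial.eval₂_add]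
      | mul_X p i hp =>
        refine Fin.cases ?_ (fun j => ?_) i <;>
          simp [hp, Polynomial.eval₂_mul, finSuccEquiv_X_zero, finSuccEquiv_X_succ]
    suffices H : ∃ w : Fin n → K, ∃ b : K, (fun i => algebraMap K ℂ (w i)) ∈ W ∧
        algebraMap K ℂ b ∈ V ∧ ∀ Q : Polynomial (MvPolynomial (Fin n) K),
          Q.eval₂ (aeval z : MvPolynomial (Fin n) K →ₐ[K] ℂ).toRingHom a = 0 →
          Q.eval₂ (eval w) b = 0 by
      obtain ⟨w, b, hw, hb, hQ⟩ := H
      refine ⟨Fin.cons b w, ?_, fun p hp => ?_⟩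
      · have h1 : (Fin.cons (algebraMap K ℂ b) (fun i => algebraMap K ℂ (w i)) :
            Fin (n + 1) → ℂ) ∈ U := hVW (Set.mk_mem_prod hb hw)
        convert h1 using 1
        ext i
        refine Fin.cases ?_ (fun j => ?_) i <;> simp
      · rw [eval_eq_eval_mv_eval', Polynomial.eval_map]
        exact hQ _ (haeval p ▸ hp)
    set φ := (aeval z : MvPolynomial (Fin n) K →ₐ[K] ℂ).toRingHom with hφ
    by_cases hex : ∃ P : Polynomial (MvPolynomial (Fin n) K), P.eval₂ φ a = 0 ∧ P.map φ ≠ 0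
    · obtain ⟨P, hPa, hlc, hmin⟩ := exists_minimal_eval₂_eq_zero hex
      have hcont : ∀ q : MvPolynomial (Fin n) K, Continuous fun x : Fin n → ℂ => aeval x q :=
        fun q => by
          simp only [aeval_def, ← eval_map]
          exact MvPolynomial.continuous_eval _
      have hcP : Continuous fun x : Fin n → ℂ =>
          P.eval₂ (aeval x : MvPolynomial (Fin n) K →ₐ[K] ℂ).toRingHom a := by
        simp only [Polynomial.eval₂_eq_sum_range]
        exact continuous_finsetSum _ fun i _ => (hcont _).mul continuous_const
      have hlt : ∀ᶠ x in nhds z,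
          ‖P.eval₂ (aeval x : MvPolynomial (Fin n) K →ₐ[K] ℂ).toRingHom a‖ <
            ‖aeval x P.leadingCoeff‖ * ε ^ P.natDegree := by
        refine hcP.norm.continuousAt.eventually_lt
          ((hcont _).norm.mul continuous_const).continuousAt ?_
        rw [← hφ, hPa, norm_zero]
        exact mul_pos (norm_pos_iff.mpr hlc) (pow_pos hε _)
      obtain ⟨w, ⟨hw, hwlt⟩, hwp⟩ := ih z (Filter.inter_mem hW hlt)
      have hcomp : ∀ q : MvPolynomial (Fin n) K,
          aeval (fun i => algebraMap K ℂ (w i)) q = algebraMap K ℂ (eval w q) := fun q => by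
        rw [← Function.comp_def, aeval_algebraMap_apply, aeval_eq_eval]
      have hringhom : (aeval (fun i => algebraMap K ℂ (w i)) :
          MvPolynomial (Fin n) K →ₐ[K] ℂ).toRingHom = (algebraMap K ℂ).comp (eval w) :=
        RingHom.ext hcomp
      simp only [Set.mem_ofPred_eq] at hwlt
      rw [hringhom, hcomp] at hwlt
      have hlcw : eval w P.leadingCoeff ≠ 0 := by
        intro h0
        rw [h0, map_zero, norm_zero, zero_mul] at hwlt
        exact absurd hwlt (not_lt.mpr (norm_nonneg _))
      obtain ⟨b, hb, hba⟩ := exists_isRoot_norm_sub_lt (P.map (eval w)) a hε.le (by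
        rwa [Polynomial.leadingCoeff_map_of_leadingCoeff_ne_zero _ hlcw,
          Polynomial.natDegree_map_of_leadingCoeff_ne_zero _ hlcw, Polynomial.aeval_def,
          Polynomial.eval₂_map])
      refine ⟨w, b, hw, hεV ?_, eval₂_eq_zero_of_minimal hwp hPa hmin hlcw ?_⟩
      · rwa [Metric.mem_ball, dist_comm, dist_eq_norm]
      · rwa [← Polynomial.eval_map]
    · push Not at hex
      obtain ⟨w, hw, hwp⟩ := ih z hW
      obtain ⟨b, hb⟩ := hK.exists_mem_open Metric.isOpen_ball ⟨a, Metric.mem_ball_self hε⟩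
      refine ⟨w, b, hw, hεV hb, fun Q hQ => ?_⟩
      rw [Polynomial.eval₂_eq_sum_range]
      refine Finset.sum_eq_zero fun k _ => ?_
      have hk : φ (Q.coeff k) = 0 := by
        rw [← Polynomial.coeff_map, hex Q hQ, Polynomial.coeff_zero]
      rw [hwp _ hk, zero_mul]

/-- The algebraic numbers are dense in `ℂ`. -/
theorem denseRange_algebraMap_algebraicClosure :
    DenseRange (algebraMap (algebraicClosure ℚ ℂ) ℂ) := by
  set K := (algebraicClosure ℚ ℂ).toSubfield
  have hI : Complex.I ∈ K.topologicalClosure :=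
    K.le_topologicalClosure (mem_algebraicClosure_iff.mpr
      (Complex.isIntegral_rat_I.isAlgebraic))
  have htop : K.topologicalClosure = ⊤ := by
    refine (Complex.subfield_eq_of_closed K.isClosed_topologicalClosure).resolve_left fun h => ?_
    rw [h] at hI
    obtain ⟨x, hx⟩ := hI
    simpa using congrArg Complex.im hx
  intro x
  have hx : x ∈ K.topologicalClosure := htop ▸ Subfield.mem_top x
  have hrange : Set.range (algebraMap (algebraicClosure ℚ ℂ) ℂ) = (K : Set ℂ) :=
    Subtype.range_coe
  rw [hrange]
  exact hx

/-- An isolated point of the common zero set in `ℂⁿ` of a family of polynomials with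
coefficients in a subfield `L ⊆ ℂ` consisting of algebraic numbers has all of its
coordinates algebraic over `ℚ`. -/
theorem isolated_zero_is_algebraic
    (L : Subfield ℂ) (hL : ∀ x : L, IsAlgebraic ℚ (x : ℂ))
    (n : ℕ) (hn : 1 ≤ n) (S : Set (MvPolynomial (Fin n) L))
    (Z : Set (Fin n → ℂ))
    (hZ : Z = {z : Fin n → ℂ | ∀ p ∈ S, MvPolynomial.eval₂ L.subtype z p = 0})
    (z₀ : Fin n → ℂ) (hz₀ : z₀ ∈ Z)
    (hiso : nhdsWithin z₀ (Z \ {z₀}) = ⊥) :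
    ∀ i, IsAlgebraic ℚ (z₀ i) := by
  let K := algebraicClosure ℚ ℂ
  have : IsAlgClosed K := (algebraicClosure.isAlgClosure ℚ ℂ).isAlgClosed
  let j : L →+* K := L.subtype.codRestrict K fun x => mem_algebraicClosure_iff.mpr (hL x)
  have hj : (algebraMap K ℂ).comp j = L.subtype := RingHom.ext fun _ => rfl
  have hU : (Z \ {z₀})ᶜ ∈ nhds z₀ := by
    rw [← Filter.disjoint_principal_right, disjoint_iff]
    exact hiso
  obtain ⟨w, hwU, hw⟩ :=
    exists_specialization_mem_nhds denseRange_algebraMap_algebraicClosure z₀ hU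
  have hwZ : (fun i => algebraMap K ℂ (w i)) ∈ Z := by
    rw [hZ] at hz₀ ⊢
    intro p hp
    have h0 : aeval z₀ (map j p) = 0 := by
      rw [aeval_def, eval₂_map, hj]
      exact hz₀ p hp
    have h1 := congrArg (algebraMap K ℂ) (hw _ h0)
    rwa [eval_map, map_zero, ← coe_eval₂Hom, map_eval₂Hom, hj] at h1
  have hwz : (fun i => algebraMap K ℂ (w i)) = z₀ := by
    by_contra hne
    exact hwU ⟨hwZ, hne⟩
  intro i
  rw [← hwz]
  exact mem_algebraicClosure_iff.mp (w i).2
end
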